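/- Let n > 3, s ≥ 1 and let Λ = (λ_1,…,λ_n), λ_j ∈ ℂ, be weakly hyperbolic. Then Z_{(Λ,n,s)} is cut out regularly: for every X = (w,z) ∈ Z_{(Λ,n,s)}, the ℝ-linear map ℂ^s × ℂ^n → ℂ × ℝ given by (a,b) ↦ (∑_{r=1}^s 2 w_r a_r + ∑_{j=1}^n λ_j (conj(z_j) b_j + z_j conj(b_j)), 2 Re(∑_{r=1}^s conj(w_r) a_r + ∑_{j=1}^n conj(z_j) b_j)) is surjective; in particular Z_{(Λ,n,s)} is a smooth submanifold of real dimension 2n + 2s − 3. -/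

import Mathlib

open scoped BigOperators

/-- `Λ` is weakly hyperbolic (`k = 2`): for every subset `J` with at most `2` elements,
`0` is not in the convex hull of the `λ_j`, `j ∈ J`. -/
def WeaklyHyperbolicC {n : ℕ} (Λ : Fin n → ℂ) : Prop :=
  ∀ J : Finset (Fin n), J.card ≤ 2 → (0 : ℂ) ∉ convexHull ℝ (Λ '' ↑J)

/-- The manifold `Z_{(Λ,n,s)} ⊆ ℂ^s × ℂ^n` cut out by
`F_s(w,z) = ∑ w_r² + ∑ λ_j |z_j|² = 0` and `ρ_s(w,z) = ∑ |w_r|² + ∑ |z_j|² = 1`. -/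
def ZLS (s : ℕ) {n : ℕ} (Λ : Fin n → ℂ) : Set ((Fin s → ℂ) × (Fin n → ℂ)) :=
  {X | (∑ r, X.1 r ^ 2) + (∑ j, Λ j * (Complex.normSq (X.2 j) : ℂ)) = 0 ∧
       (∑ r, Complex.normSq (X.1 r)) + (∑ j, Complex.normSq (X.2 j)) = 1}

open ComplexConjugate

section LevelSet

variable {E F : Type*} [NormedAddCommGroup E] [NormedSpace ℝ E] [FiniteDimensional ℝ E]
  [NormedAddCommGroup F] [NormedSpace ℝ F] [FiniteDimensional ℝ F]

/-- Near a point where `f` is a submersion, the level set of `f` is locally homeomorphic to a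
Euclidean space of dimension `dim E - dim F`. -/
theorem HasStrictFDerivAt.exists_levelSet_chart {f : E → F} {f' : E →L[ℝ] F} {c : F} {d : ℕ}
    (a : {x | f x = c}) (hf : HasStrictFDerivAt f f' a) (hf' : f'.range = ⊤)
    (hd : Module.finrank ℝ E = Module.finrank ℝ F + d) :
    ∃ φ : OpenPartialHomeomorph {x | f x = c} (EuclideanSpace ℝ (Fin d)), a ∈ φ.source := by
  classical
  have : CompleteSpace E := FiniteDimensional.complete ℝ E
  have hker : Module.finrank ℝ f'.ker = Module.finrank ℝ (EuclideanSpace ℝ (Fin d)) := by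
    have h := LinearMap.finrank_range_add_finrank_ker (f' : E →ₗ[ℝ] F)
    rw [hf', finrank_top] at h
    rw [finrank_euclideanSpace_fin]
    omega
  let e : f'.ker ≃L[ℝ] EuclideanSpace ℝ (Fin d) := ContinuousLinearEquiv.ofFinrankEq hker
  let ψ := hf.implicitToOpenPartialHomeomorph f f' hf'
  have hψ (x : E) : (ψ x).1 = f x := hf.implicitToOpenPartialHomeomorph_fst hf' x
  have hψc (x : {x | f x = c}) : (c, (ψ x).2) = ψ x := Prod.ext ((hψ x).trans x.2).symm rfl
  have hlevel {y} (hy : (c, e.symm y) ∈ ψ.target) : f (ψ.symm (c, e.symm y)) = c := by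
    rw [← hψ, ψ.right_inv hy]
  let g (y : EuclideanSpace ℝ (Fin d)) : {x | f x = c} :=
    if hy : (c, e.symm y) ∈ ψ.target then ⟨ψ.symm (c, e.symm y), hlevel hy⟩ else a
  have hg {y} (hy : (c, e.symm y) ∈ ψ.target) : (g y : E) = ψ.symm (c, e.symm y) := by
    simp only [g, dif_pos hy]
  have hslice : Continuous fun y => (c, e.symm y) := by fun_prop
  refine ⟨{ toFun := fun x => e (ψ x).2
            invFun := g
            source := {x | (x : E) ∈ ψ.source}
            target := {y | (c, e.symm y) ∈ ψ.target}
            map_source' := ?_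
            map_target' := ?_
            left_inv' := ?_
            right_inv' := ?_
            continuousOn_toFun := ?_
            continuousOn_invFun := ?_
            open_source := ψ.open_source.preimage continuous_subtype_val
            open_target := ψ.open_target.preimage hslice },
    hf.mem_implicitToOpenPartialHomeomorph_source hf'⟩
  · intro x hx
    simpa [hψc] using ψ.map_source hx
  · intro y hy
    simpa [hg hy] using ψ.map_target hy
  · intro x hx
    have hy : (c, e.symm (e (ψ x).2)) ∈ ψ.target := by simpa [hψc] using ψ.map_source hx
    apply Subtype.ext
    rw [hg hy, e.symm_apply_apply, hψc, ψ.left_inv hx]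
  · intro y hy
    rw [hg hy, ψ.right_inv hy, e.apply_symm_apply]
  · exact e.continuous.comp_continuousOn (continuous_snd.comp_continuousOn
      (ψ.continuousOn.comp continuous_subtype_val.continuousOn fun x hx => hx))
  · exact Topology.IsInducing.subtypeVal.continuousOn_iff.mpr
      ((ψ.continuousOn_symm.comp hslice.continuousOn fun y hy => hy).congr fun y hy => hg hy)

/-- A regular level set carries charts with values in a Euclidean space of dimension
`dim E - dim F`. -/
theorem nonempty_chartedSpace_levelSet {f : E → F} {f' : E → E →L[ℝ] F} {c : F} {d : ℕ}
    (hf : ∀ x, f x = c → HasStrictFDerivAt f (f' x) x)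
    (hf' : ∀ x, f x = c → (f' x).range = ⊤)
    (hd : Module.finrank ℝ E = Module.finrank ℝ F + d) :
    Nonempty (ChartedSpace (EuclideanSpace ℝ (Fin d)) {x | f x = c}) := by
  choose φ hφ using fun a : {x | f x = c} =>
    HasStrictFDerivAt.exists_levelSet_chart a (hf a a.2) (hf' a a.2) hd
  exact ⟨{ atlas := Set.range φ
           chartAt := φ
           mem_chart_source := hφ
           chart_mem_atlas := Set.mem_range_self }⟩

end LevelSet

/-- Weakly hyperbolic coefficients lying on a real line through the origin admit no nontrivial
nonnegative linear relation. -/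
theorem WeaklyHyperbolicC.eq_zero_of_mul_re_eq_zero {n : ℕ} {Λ : Fin n → ℂ}
    (hΛ : WeaklyHyperbolicC Λ) {c : ℂ} (hc : c ≠ 0) {p : Fin n → ℝ} (hp : ∀ j, 0 ≤ p j)
    (hre : ∀ j, p j ≠ 0 → (c * Λ j).re = 0) (hsum : ∑ j, Λ j * (p j : ℂ) = 0) (j : Fin n) :
    p j = 0 := by
  classical
  have him : ∑ j, (c * Λ j).im * p j = 0 := by
    have h := congrArg (fun u : ℂ => (c * u).im) hsum
    simpa [Finset.mul_sum, ← mul_assoc, Complex.im_mul_ofReal] using h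
  have hne (i : Fin n) (hi : p i ≠ 0) : (c * Λ i).im ≠ 0 := by
    intro h
    have h0 : c * Λ i = 0 := Complex.ext (hre i hi) h
    have hΛi : Λ i = 0 := (mul_eq_zero.mp h0).resolve_left hc
    refine hΛ {i} (by simp) ?_
    simp [hΛi]
  by_contra hj
  have hex : ∃ k, (c * Λ k).im * p k ≠ 0 := ⟨j, mul_ne_zero (hne j hj) hj⟩
  obtain ⟨k, -, hk⟩ := Finset.exists_pos_of_sum_zero_of_exists_nonzero
    (s := Finset.univ) _ him (by simpa using hex)
  obtain ⟨l, -, hl⟩ := Finset.exists_pos_of_sum_zero_of_exists_nonzero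
    (s := Finset.univ) (fun i => -((c * Λ i).im * p i)) (by simpa using him) (by simpa using hex)
  have hpk : p k ≠ 0 := by rintro h; simp [h] at hk
  have hpl : p l ≠ 0 := by rintro h; simp [h] at hl
  have hk0 : 0 < (c * Λ k).im := pos_of_mul_pos_left hk (hp k)
  have hl0 : (c * Λ l).im < 0 := by
    have : 0 < -(c * Λ l).im * p l := by linarith
    linarith [pos_of_mul_pos_left this (hp l)]
  set x := (c * Λ k).im
  set y := -(c * Λ l).im with hy
  have hy0 : 0 < y := by linarith
  have hrel : (y : ℂ) * Λ k + (x : ℂ) * Λ l = 0 := by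
    have h0 : c * ((y : ℂ) * Λ k + (x : ℂ) * Λ l) = 0 := by
      have hkc : c * Λ k = x * Complex.I := by
        rw [← Complex.re_add_im (c * Λ k), hre k hpk, Complex.ofReal_zero, zero_add]
      have hlc : c * Λ l = -y * Complex.I := by
        rw [← Complex.re_add_im (c * Λ l), hre l hpl, hy]
        push_cast
        ring
      linear_combination (y : ℂ) * hkc + (x : ℂ) * hlc
    exact (mul_eq_zero.mp h0).resolve_left hc
  refine hΛ {k, l} Finset.card_le_two ?_
  rw [Finset.coe_pair, Set.image_pair, convexHull_pair]
  refine ⟨y / (x + y), x / (x + y), by positivity, by positivity, by field_simp; ring, ?_⟩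
  have hxy : ((x : ℂ) + y) ≠ 0 := by exact_mod_cast (by positivity : x + y ≠ 0)
  simp only [Complex.real_smul]
  push_cast
  field_simp
  linear_combination hrel

/-- The defining map `(F_s, ρ_s)` of `ZLS s Λ`. -/
noncomputable def zlsMap (s : ℕ) {n : ℕ} (Λ : Fin n → ℂ) (X : (Fin s → ℂ) × (Fin n → ℂ)) : ℂ × ℝ :=
  ((∑ r, X.1 r ^ 2) + ∑ j, Λ j * (Complex.normSq (X.2 j) : ℂ),
    (∑ r, Complex.normSq (X.1 r)) + ∑ j, Complex.normSq (X.2 j))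

/-- The real derivative of `zlsMap s Λ`. -/
noncomputable def zlsDeriv (s : ℕ) {n : ℕ} (Λ : Fin n → ℂ) (X : (Fin s → ℂ) × (Fin n → ℂ)) :
    (Fin s → ℂ) × (Fin n → ℂ) →L[ℝ] ℂ × ℝ :=
  LinearMap.toContinuousLinearMap
    { toFun := fun v => ((∑ r, 2 * X.1 r * v.1 r) + ∑ j, Λ j * (conj (X.2 j) * v.2 j +
          X.2 j * conj (v.2 j)),
        2 * ((∑ r, conj (X.1 r) * v.1 r) + ∑ j, conj (X.2 j) * v.2 j).re)
      map_add' := fun u v => by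
        simp only [Prod.fst_add, Prod.snd_add, Pi.add_apply, map_add, mul_add,
          Finset.sum_add_distrib, Complex.add_re, Prod.mk_add_mk]
        congr 1 <;> ring
      map_smul' := fun t v => by
        have hre (z : ℂ) : t * z.re = (t * z).re := by simp
        simp only [Prod.smul_fst, Prod.smul_snd, Pi.smul_apply, Complex.real_smul, map_mul,
          Complex.conj_ofReal, RingHom.id_apply, Prod.smul_mk, smul_eq_mul]
        rw [mul_left_comm, hre]
        simp only [mul_add, Finset.mul_sum, mul_left_comm _ (t : ℂ)] }

theorem zlsDeriv_apply (s : ℕ) {n : ℕ} (Λ : Fin n → ℂ) (X v : (Fin s → ℂ) × (Fin n → ℂ)) :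
    zlsDeriv s Λ X v = ((∑ r, 2 * X.1 r * v.1 r) + ∑ j, Λ j * (conj (X.2 j) * v.2 j +
          X.2 j * conj (v.2 j)),
        2 * ((∑ r, conj (X.1 r) * v.1 r) + ∑ j, conj (X.2 j) * v.2 j).re) :=
  rfl

theorem hasStrictFDerivAt_zlsMap (s : ℕ) {n : ℕ} (Λ : Fin n → ℂ)
    (X : (Fin s → ℂ) × (Fin n → ℂ)) :
    HasStrictFDerivAt (zlsMap s Λ) (zlsDeriv s Λ X) X := by
  have hw (r : Fin s) : HasStrictFDerivAt (fun Y : (Fin s → ℂ) × (Fin n → ℂ) => Y.1 r)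
      ((ContinuousLinearMap.proj r).comp (ContinuousLinearMap.fst ℝ (Fin s → ℂ) (Fin n → ℂ))) X :=
    ((ContinuousLinearMap.proj r).comp
      (ContinuousLinearMap.fst ℝ (Fin s → ℂ) (Fin n → ℂ))).hasStrictFDerivAt
  have hz (j : Fin n) : HasStrictFDerivAt (fun Y : (Fin s → ℂ) × (Fin n → ℂ) => Y.2 j)
      ((ContinuousLinearMap.proj j).comp (ContinuousLinearMap.snd ℝ (Fin s → ℂ) (Fin n → ℂ))) X :=
    ((ContinuousLinearMap.proj j).comp
      (ContinuousLinearMap.snd ℝ (Fin s → ℂ) (Fin n → ℂ))).hasStrictFDerivAt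
  have hconj {g : (Fin s → ℂ) × (Fin n → ℂ) → ℂ} {g'} (hg : HasStrictFDerivAt g g' X) :=
    (Complex.conjCLE.toContinuousLinearMap.hasStrictFDerivAt (x := g X)).comp X hg
  have hF := (HasStrictFDerivAt.fun_sum fun r (_ : r ∈ Finset.univ) => (hw r).mul (hw r)).add
    (HasStrictFDerivAt.fun_sum fun j (_ : j ∈ Finset.univ) =>
      ((hz j).mul (hconj (hz j))).const_mul (Λ j))
  have hρ := Complex.reCLM.hasStrictFDerivAt.comp X
    ((HasStrictFDerivAt.fun_sum fun r (_ : r ∈ Finset.univ) => (hw r).mul (hconj (hw r))).add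
    (HasStrictFDerivAt.fun_sum fun j (_ : j ∈ Finset.univ) => (hz j).mul (hconj (hz j))))
  have hmap := hF.prodMk hρ
  refine (hmap.congr_fderiv ?_).congr_of_eventuallyEq (.of_forall fun Y => ?_)
  · refine ContinuousLinearMap.ext fun v => ?_
    rw [zlsDeriv_apply]
    apply Prod.ext
    · simp [← two_mul, mul_assoc, mul_add, add_comm]
    · simp [← two_mul, Finset.mul_sum, mul_add]
  · simp [zlsMap, Complex.mul_conj, Complex.normSq_apply, pow_two]

/-- A covector annihilating the image of the derivative at a point of `ZLS s Λ` vanishes. -/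
theorem covector_eq_zero_of_mem_ZLS {n s : ℕ} {Λ : Fin n → ℂ} (hΛ : WeaklyHyperbolicC Λ)
    {X : (Fin s → ℂ) × (Fin n → ℂ)} (hX : X ∈ ZLS s Λ) {c : ℂ} {t : ℝ}
    (h : ∀ v, (c * (zlsDeriv s Λ X v).1).re + t * (zlsDeriv s Λ X v).2 = 0) :
    c = 0 ∧ t = 0 := by
  classical
  obtain ⟨hF, hρ⟩ := hX
  have hw (r : Fin s) : c * X.1 r = -(t * conj (X.1 r)) := by
    have hr := h (Pi.single r (conj (c * X.1 r + t * conj (X.1 r))), 0)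
    simp only [zlsDeriv_apply, Pi.single_apply] at hr
    simp only [Pi.zero_apply, mul_ite, mul_zero, map_zero, add_zero, Finset.sum_const_zero,
      Finset.sum_ite_eq', Finset.mem_univ, if_true] at hr
    rw [← add_eq_zero_iff_eq_neg, ← Complex.normSq_eq_zero]
    have : 2 * Complex.normSq (c * X.1 r + t * conj (X.1 r)) = 0 := by
      rw [← hr]
      simp [Complex.normSq_apply]
      ring
    linarith
  have hz (j : Fin n) : ((c * Λ j).re + t) * Complex.normSq (X.2 j) = 0 := by
    have hj := h (0, Pi.single j (X.2 j))
    simp only [zlsDeriv_apply, Pi.single_apply] at hj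
    simp only [Pi.zero_apply, mul_ite, apply_ite conj, mul_zero, map_zero, add_zero, zero_add,
      ite_add_ite, Finset.sum_const_zero, Finset.sum_ite_eq', Finset.mem_univ, if_true] at hj
    have : 2 * (((c * Λ j).re + t) * Complex.normSq (X.2 j)) = 0 := by
      rw [← hj]
      simp [Complex.normSq_apply]
      ring
    linarith
  have ht : t = 0 := by
    have hFc := congrArg (fun u => (c * u).re) hF
    simp only [mul_add, Finset.mul_sum, Complex.add_re, Complex.re_sum, mul_zero,
      Complex.zero_re] at hFc
    have h1 (r : Fin s) : (c * X.1 r ^ 2).re = -t * Complex.normSq (X.1 r) := by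
      rw [pow_two, ← mul_assoc, hw r]
      simp [Complex.normSq_apply]
      ring
    have h2 (j : Fin n) : (c * (Λ j * (Complex.normSq (X.2 j) : ℂ))).re =
        -t * Complex.normSq (X.2 j) := by
      rw [← mul_assoc, Complex.re_mul_ofReal]
      linarith [hz j]
    simp only [h1, h2, ← Finset.mul_sum, ← mul_add, hρ] at hFc
    linarith
  refine ⟨?_, ht⟩
  by_contra hc
  have hw0 (r : Fin s) : X.1 r = 0 := by
    have := hw r
    simpa [ht, hc] using this
  have hz0 := hΛ.eq_zero_of_mul_re_eq_zero hc (p := fun j => Complex.normSq (X.2 j))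
    (fun j => Complex.normSq_nonneg _)
    (fun j hj => by simpa [ht, -Complex.mul_re] using (mul_eq_zero.mp (hz j)).resolve_right hj)
    (by simpa [hw0] using hF)
  simp [hw0, hz0] at hρ

theorem range_zlsDeriv_eq_top {n s : ℕ} {Λ : Fin n → ℂ} (hΛ : WeaklyHyperbolicC Λ)
    {X : (Fin s → ℂ) × (Fin n → ℂ)} (hX : X ∈ ZLS s Λ) :
    (zlsDeriv s Λ X).range = ⊤ := by
  by_contra hne
  obtain ⟨φ, hφ, hle⟩ := Submodule.exists_le_ker_of_lt_top _ (lt_top_iff_ne_top.mpr hne)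
  have hrepr (u : ℂ) (x : ℝ) :
      φ (u, x) = ((⟨φ (1, 0), -φ (Complex.I, 0)⟩ : ℂ) * u).re + φ (0, 1) * x := by
    have hux : (u, x) = u.re • ((1, 0) : ℂ × ℝ) + u.im • ((Complex.I, 0) : ℂ × ℝ) +
        x • ((0, 1) : ℂ × ℝ) := by
      ext <;> simp
    rw [hux]
    simp only [map_add, map_smul]
    simp
    ring
  obtain ⟨hc, ht⟩ := covector_eq_zero_of_mem_ZLS hΛ hX
    (c := ⟨φ (1, 0), -φ (Complex.I, 0)⟩) (t := φ (0, 1)) fun v => by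
      rw [← hrepr]
      exact hle ⟨v, rfl⟩
  refine hφ (LinearMap.ext fun u => ?_)
  rw [← Prod.mk.eta (p := u), hrepr, hc, ht]
  simp

/-- `Z_{(Λ,n,s)}` is cut out regularly: at every `X = (w,z) ∈ Z_{(Λ,n,s)}` the real derivative
`(a,b) ↦ (∑ 2 w_r a_r + ∑ λ_j (conj(z_j) b_j + z_j conj(b_j)),
          2 Re(∑ conj(w_r) a_r + ∑ conj(z_j) b_j))`
is surjective onto `ℂ × ℝ`; in particular `Z_{(Λ,n,s)}` is a smooth submanifold of real
dimension `2n + 2s - 3` (here expressed as: it is locally modelled on `ℝ^{2n+2s-3}`). -/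
theorem ZLS_regular {n s : ℕ} (hn : 3 < n) (hs : 1 ≤ s)
    (Λ : Fin n → ℂ) (hΛ : WeaklyHyperbolicC Λ) :
    (∀ X ∈ ZLS s Λ, Function.Surjective (fun v : (Fin s → ℂ) × (Fin n → ℂ) =>
      (((∑ r, 2 * X.1 r * v.1 r) +
          ∑ j, Λ j * ((starRingEnd ℂ) (X.2 j) * v.2 j + X.2 j * (starRingEnd ℂ) (v.2 j)),
        2 * ((∑ r, (starRingEnd ℂ) (X.1 r) * v.1 r) +
          ∑ j, (starRingEnd ℂ) (X.2 j) * v.2 j).re) : ℂ × ℝ))) ∧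
    Nonempty (ChartedSpace (EuclideanSpace ℝ (Fin (2 * n + 2 * s - 3))) ↥(ZLS s Λ)) := by
  refine ⟨fun X hX => LinearMap.range_eq_top.mp (range_zlsDeriv_eq_top hΛ hX), ?_⟩
  have hmem (X : (Fin s → ℂ) × (Fin n → ℂ)) : zlsMap s Λ X = (0, 1) ↔ X ∈ ZLS s Λ := Prod.ext_iff
  have hZ : ZLS s Λ = {X | zlsMap s Λ X = (0, 1)} := Set.ext fun X => (hmem X).symm
  rw [hZ]
  refine nonempty_chartedSpace_levelSet (fun X _ => hasStrictFDerivAt_zlsMap s Λ X)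
    (fun X hX => range_zlsDeriv_eq_top hΛ ((hmem X).mp hX)) ?_
  simp only [Module.finrank_prod, Module.finrank_pi_fintype, Complex.finrank_real_complex,
    Module.finrank_self, Finset.sum_const, Finset.card_univ, Fintype.card_fin, smul_eq_mul]
  omega
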